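/- Let d be a positive integer and let O ⊆ ℝ^d be a union of (finitely many, pairwise disjoint) open orthants of ℝ^d. For every ε > 0 there exists an infinitely differentiable function Ψ_O : ℝ^d → [0,1] such that: (1) Ψ_O(X) = 0 for all X ∉ O; (2) Ψ_O(X) = 1 for all X ∈ O with min_i |X_i| ≥ ε; (3) for every multi-index J ∈ ℕ^d with |J| = k ≥ 1, the iterated partial derivative ∂^J Ψ_O := ∂^{J_1}_{x_1} ⋯ ∂^{J_d}_{x_d} Ψ_O satisfies sup_{X ∈ ℝ^d} |∂^J Ψ_O(X)| ≤ α(k) · (1/ε)^k; and (4) for every multi-index J ∈ ℕ^d and every X ∈ ℝ^d, ∂^J Ψ_O(X) ≠ 0 only if X ∈ O and |X_i| ≤ ε for every i with J_i ≠ 0. -/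

import Mathlib

/-- The derivative-bound function α(k) = 2e · 64^k · k! · k^{2k+2}. -/
noncomputable def mollifierBound (k : ℕ) : ℝ :=
  2 * Real.exp 1 * 64 ^ k * (Nat.factorial k : ℝ) * (k : ℝ) ^ (2 * k + 2)

/-- The partial derivative ∂_{x_i} of a function on ℝ^d. -/
noncomputable def partialDeriv {d : ℕ} (i : Fin d) (f : (Fin d → ℝ) → ℝ) :
    (Fin d → ℝ) → ℝ :=
  fun x => fderiv ℝ f x (Pi.single i 1)

/-- The multi-index iterated partial derivative ∂^J = ∂^{J_1}_{x_1} ⋯ ∂^{J_d}_{x_d}. -/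
noncomputable def multiDeriv {d : ℕ} (J : Fin d → ℕ) (f : (Fin d → ℝ) → ℝ) :
    (Fin d → ℝ) → ℝ :=
  (List.finRange d).foldr (fun i g => (partialDeriv i)^[J i] g) f

open Polynomial in
lemma aux_hasDerivAt (m : ℕ) (x : ℝ) :
    HasDerivAt (fun x : ℝ => x⁻¹ ^ m * expNegInvGlue x)
      (x⁻¹ ^ (m + 2) * expNegInvGlue x - m * (x⁻¹ ^ (m + 1) * expNegInvGlue x)) x := by
  have h := expNegInvGlue.hasDerivAt_polynomial_eval_inv_mul (X ^ m) x
  simp only [eval_pow, eval_X, eval_mul, eval_sub, derivative_X_pow, eval_C] at h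
  convert h using 1
  rcases m with _ | m
  · simp
  · simp
    ring

lemma aux_contDiff (m : ℕ) (n : ℕ∞) : ContDiff ℝ n (fun x : ℝ => x⁻¹ ^ m * expNegInvGlue x) := by
  simpa using expNegInvGlue.contDiff_polynomial_eval_inv_mul (n := n) (Polynomial.X ^ m)

lemma aux_bound_zero (m : ℕ) (x : ℝ) : |x⁻¹ ^ m * expNegInvGlue x| ≤ (m.factorial : ℝ) := by
  rcases le_or_gt x 0 with hx | hx
  · rw [expNegInvGlue.zero_of_nonpos hx]
    simp
  · have h1 := Real.pow_div_factorial_le_exp x⁻¹ (inv_pos.2 hx).le m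
    have hm : (0 : ℝ) < m.factorial := by positivity
    rw [expNegInvGlue, if_neg hx.not_ge, abs_of_nonneg (by positivity), Real.exp_neg,
      ← div_eq_mul_inv, div_le_iff₀ (Real.exp_pos _)]
    rw [div_le_iff₀ hm] at h1
    linarith

lemma aux_bound (n : ℕ) : ∀ (m : ℕ) (x : ℝ),
    |iteratedDeriv n (fun x : ℝ => x⁻¹ ^ m * expNegInvGlue x) x|
      ≤ 2 ^ n * ((m + 2 * n).factorial : ℝ) := by
  induction n with
  | zero => intro m x; simpa using aux_bound_zero m x
  | succ n ih =>
    intro m x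
    have hd : deriv (fun x : ℝ => x⁻¹ ^ m * expNegInvGlue x) =
        (fun x : ℝ => x⁻¹ ^ (m + 2) * expNegInvGlue x) -
          (fun x : ℝ => (m : ℝ) * (x⁻¹ ^ (m + 1) * expNegInvGlue x)) := by
      funext x
      exact (aux_hasDerivAt m x).deriv
    rw [iteratedDeriv_succ', hd, iteratedDeriv_sub (aux_contDiff _ n).contDiffAt
      (contDiff_const.mul (aux_contDiff _ n)).contDiffAt, iteratedDeriv_const_mul_field]
    have h1 := ih (m + 2) x
    have h2 := ih (m + 1) x
    have h3 : ((m + 1 + 2 * n).factorial : ℝ) * m ≤ ((m + 2 + 2 * n).factorial : ℝ) := by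
      rw [show m + 2 + 2 * n = (m + 1 + 2 * n) + 1 by ring, Nat.factorial_succ]
      push_cast
      have : (0 : ℝ) ≤ ((m + 1 + 2 * n).factorial : ℝ) := by positivity
      nlinarith [mul_nonneg this (Nat.cast_nonneg (α := ℝ) n)]
    refine (abs_sub _ _).trans ?_
    rw [abs_mul, Nat.abs_cast, show m + 2 * (n + 1) = m + 2 + 2 * n by ring]
    have h4 := mul_le_mul_of_nonneg_left h2 (Nat.cast_nonneg (α := ℝ) m)
    have h5 := mul_le_mul_of_nonneg_left h3 (show (0 : ℝ) ≤ 2 ^ n by positivity)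
    rw [pow_succ]
    linarith

lemma aux_glue_bound (n : ℕ) (x : ℝ) :
    |iteratedDeriv n expNegInvGlue x| ≤ 8 ^ n * (n.factorial : ℝ) ^ 2 := by
  have h := aux_bound n 0 x
  simp only [pow_zero, one_mul, zero_add] at h
  refine h.trans ?_
  have h2 : (2 * n).factorial ≤ 4 ^ n * n.factorial ^ 2 := by
    have h3 := Nat.choose_mul_factorial_mul_factorial (show n ≤ 2 * n by omega)
    have h4 : (2 * n).choose n ≤ 4 ^ n := by
      have := Nat.choose_le_two_pow (2 * n) n
      rwa [pow_mul] at this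
    rw [← h3, show 2 * n - n = n by omega, mul_assoc, ← sq]
    exact Nat.mul_le_mul_right _ h4
  have h2' : ((2 * n).factorial : ℝ) ≤ 4 ^ n * (n.factorial : ℝ) ^ 2 := by exact_mod_cast h2
  calc _ ≤ (2 : ℝ) ^ n * (4 ^ n * (n.factorial : ℝ) ^ 2) := by gcongr
    _ = _ := by rw [← mul_assoc, ← mul_pow]; norm_num

noncomputable def bumpG (x : ℝ) : ℝ := expNegInvGlue (4 * x) * expNegInvGlue (4 * (1 - x))

lemma bumpG_contDiff (n : ℕ∞) : ContDiff ℝ n bumpG := by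
  unfold bumpG
  exact (expNegInvGlue.contDiff.comp (by fun_prop)).mul (expNegInvGlue.contDiff.comp (by fun_prop))

lemma bumpG_bound (n : ℕ) (x : ℝ) :
    |iteratedDeriv n bumpG x| ≤ (n + 1) * 32 ^ n * (n.factorial : ℝ) ^ 2 := by
  have hc : ∀ k : ℕ, ContDiff ℝ k (fun x : ℝ => expNegInvGlue (4 * x)) := fun k =>
    (expNegInvGlue.contDiff (n := k)).comp (by fun_prop)
  have hc' : ∀ k : ℕ, ContDiff ℝ k (fun x : ℝ => expNegInvGlue (4 * (1 - x))) := fun k =>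
    (expNegInvGlue.contDiff (n := k)).comp (by fun_prop)
  have hb : ∀ (k : ℕ) (y : ℝ), |iteratedDeriv k (fun x : ℝ => expNegInvGlue (4 * x)) y|
      ≤ 32 ^ k * (k.factorial : ℝ) ^ 2 := by
    intro k y
    rw [iteratedDeriv_comp_const_mul (expNegInvGlue.contDiff (n := k)), abs_mul, abs_pow]
    calc _ ≤ |(4 : ℝ)| ^ k * (8 ^ k * (k.factorial : ℝ) ^ 2) := by
          gcongr; exact aux_glue_bound _ _
      _ = _ := by
        rw [← mul_assoc, ← mul_pow]; norm_num
  have hb' : ∀ (k : ℕ) (y : ℝ), |iteratedDeriv k (fun x : ℝ => expNegInvGlue (4 * (1 - x))) y|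
      ≤ 32 ^ k * (k.factorial : ℝ) ^ 2 := by
    intro k y
    have := iteratedDeriv_comp_const_sub (n := k) (f := fun x : ℝ => expNegInvGlue (4 * x))
      (s := (1 : ℝ))
    rw [this]
    simpa [abs_mul] using hb k (1 - y)
  have he : bumpG = (fun x : ℝ => expNegInvGlue (4 * x)) *
    (fun x : ℝ => expNegInvGlue (4 * (1 - x))) := rfl
  rw [he, iteratedDeriv_mul (hc n).contDiffAt (hc' n).contDiffAt]
  refine (Finset.abs_sum_le_sum_abs _ _).trans ?_
  have : ∀ i ∈ Finset.range (n + 1),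
      |(n.choose i : ℝ) * iteratedDeriv i (fun x : ℝ => expNegInvGlue (4 * x)) x *
        iteratedDeriv (n - i) (fun x : ℝ => expNegInvGlue (4 * (1 - x))) x|
      ≤ 32 ^ n * (n.factorial : ℝ) ^ 2 := by
    intro i hi
    have hi' : i ≤ n := by simpa [Nat.lt_succ_iff] using hi
    rw [abs_mul, abs_mul, Nat.abs_cast]
    have hf := Nat.choose_mul_factorial_mul_factorial hi'
    have hle : i.factorial * (n - i).factorial ≤ n.factorial :=
      Nat.le_of_dvd (Nat.factorial_pos _) (Nat.factorial_mul_factorial_dvd_factorial hi')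
    have hf' : (n.choose i : ℝ) * (i.factorial : ℝ) * ((n - i).factorial : ℝ) = n.factorial := by
      exact_mod_cast hf
    have hle' : (i.factorial : ℝ) * ((n - i).factorial : ℝ) ≤ n.factorial := by
      exact_mod_cast hle
    calc _ ≤ (n.choose i : ℝ) * (32 ^ i * (i.factorial : ℝ) ^ 2) *
          (32 ^ (n - i) * ((n - i).factorial : ℝ) ^ 2) := by
          gcongr
          · exact hb _ _
          · exact hb' _ _
      _ = (32 ^ i * 32 ^ (n - i)) * (((n.choose i : ℝ) * (i.factorial : ℝ) * ((n - i).factorial : ℝ))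
          * ((i.factorial : ℝ) * ((n - i).factorial : ℝ))) := by ring
      _ ≤ 32 ^ n * ((n.factorial : ℝ) * n.factorial) := by
          rw [hf', ← pow_add, Nat.add_sub_cancel' hi']
          gcongr
      _ = _ := by ring
  refine (Finset.sum_le_sum this).trans ?_
  simp only [Finset.sum_const, Finset.card_range, nsmul_eq_mul]
  push_cast
  linarith

lemma bumpG_nonneg (x : ℝ) : 0 ≤ bumpG x :=
  mul_nonneg (expNegInvGlue.nonneg _) (expNegInvGlue.nonneg _)

lemma bumpG_cont : Continuous bumpG := (bumpG_contDiff 0).continuous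

lemma bumpG_int_lower : (1 / 16 : ℝ) ≤ ∫ x in (0:ℝ)..1, bumpG x := by
  have hi : ∀ a b, IntervalIntegrable bumpG MeasureTheory.volume a b :=
    fun a b => bumpG_cont.intervalIntegrable a b
  have h1 : ∫ x in (1/4:ℝ)..(3/4), (1/8 : ℝ) ≤ ∫ x in (1/4:ℝ)..(3/4), bumpG x := by
    apply intervalIntegral.integral_mono_on (by norm_num) (by simp) (hi _ _)
    intro x hx
    have he : Real.exp (-1) ≤ expNegInvGlue 1 := by
      rw [expNegInvGlue, if_neg (by norm_num), inv_one]
    have ha : Real.exp (-1) ≤ expNegInvGlue (4 * x) :=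
      he.trans (expNegInvGlue.monotone (by linarith [hx.1]))
    have hb : Real.exp (-1) ≤ expNegInvGlue (4 * (1 - x)) :=
      he.trans (expNegInvGlue.monotone (by linarith [hx.2]))
    have hc : (0.36 : ℝ) ≤ Real.exp (-1) := by
      rw [Real.exp_neg]
      have := Real.exp_one_lt_d9
      rw [le_inv_comm₀ (by norm_num) (Real.exp_pos _)]
      norm_num
      linarith
    have := mul_le_mul (hc.trans ha) (hc.trans hb) (by norm_num) (expNegInvGlue.nonneg _)
    unfold bumpG
    norm_num at this ⊢
    linarith
  have h2 : ∫ x in (1/4:ℝ)..(3/4), bumpG x ≤ ∫ x in (0:ℝ)..1, bumpG x := by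
    apply intervalIntegral.integral_mono_interval (by norm_num) (by norm_num) (by norm_num) _ (hi _ _)
    exact Filter.Eventually.of_forall bumpG_nonneg
  refine le_trans ?_ (h1.trans h2)
  rw [intervalIntegral.integral_const]
  norm_num

noncomputable def betaB (k : ℕ) : ℝ := 64 ^ k * (k.factorial : ℝ) * (k : ℝ) ^ (2 * k)

lemma exists_step : ∃ ψ : ℝ → ℝ, ContDiff ℝ (⊤ : ℕ∞) ψ ∧ (∀ x, 0 ≤ ψ x) ∧ (∀ x, ψ x ≤ 1) ∧
    (∀ x ≤ 0, ψ x = 0) ∧ (∀ x, 1 ≤ x → ψ x = 1) ∧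
    ∀ n x, |iteratedDeriv n ψ x| ≤ betaB n := by
  set I := ∫ x in (0:ℝ)..1, bumpG x with hI
  have hIl : (1 / 16 : ℝ) ≤ I := bumpG_int_lower
  have hIpos : 0 < I := by linarith
  have hi : ∀ a b, IntervalIntegrable bumpG MeasureTheory.volume a b :=
    fun a b => bumpG_cont.intervalIntegrable a b
  set ψ : ℝ → ℝ := fun x => (∫ t in (0:ℝ)..x, bumpG t) * I⁻¹ with hψ
  have hderiv : ∀ x, HasDerivAt ψ (bumpG x * I⁻¹) x := fun x =>
    (intervalIntegral.integral_hasDerivAt_right (hi _ _)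
      bumpG_cont.stronglyMeasurable.stronglyMeasurableAtFilter bumpG_cont.continuousAt).mul_const _
  have hd : deriv ψ = fun x => bumpG x * I⁻¹ := funext fun x => (hderiv x).deriv
  have hsm : ContDiff ℝ (⊤ : ℕ∞) ψ := by
    rw [contDiff_infty_iff_deriv]
    refine ⟨fun x => (hderiv x).differentiableAt, ?_⟩
    rw [hd]
    exact (bumpG_contDiff ⊤).mul contDiff_const
  have hmono : Monotone ψ := by
    apply monotone_of_deriv_nonneg (fun x => (hderiv x).differentiableAt)
    intro x
    rw [hd]
    exact mul_nonneg (bumpG_nonneg x) (by positivity)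
  have hz : ∀ x ≤ 0, ψ x = 0 := by
    intro x hx
    have : ∫ t in (0:ℝ)..x, bumpG t = ∫ t in (0:ℝ)..x, (0 : ℝ) := by
      apply intervalIntegral.integral_congr
      intro t ht
      rw [Set.uIcc_of_ge hx] at ht
      simp only [bumpG]
      rw [expNegInvGlue.zero_of_nonpos (by linarith [ht.2]), zero_mul]
    simp [hψ, this]
  have ho : ∀ x, 1 ≤ x → ψ x = 1 := by
    intro x hx
    have h0 : ∫ t in (1:ℝ)..x, bumpG t = ∫ t in (1:ℝ)..x, (0 : ℝ) := by
      apply intervalIntegral.integral_congr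
      intro t ht
      rw [Set.uIcc_of_le hx] at ht
      simp only [bumpG]
      rw [expNegInvGlue.zero_of_nonpos (x := 4 * (1 - t)) (by linarith [ht.1]), mul_zero]
    have h1 := intervalIntegral.integral_add_adjacent_intervals (hi 0 1) (hi 1 x)
    rw [h0] at h1
    simp only [intervalIntegral.integral_zero, add_zero] at h1
    simp only [hψ]
    rw [← h1, mul_inv_cancel₀ hIpos.ne']
  have h01 : ∀ x, 0 ≤ ψ x := by
    intro x
    rcases le_total x 0 with h | h
    · rw [hz x h]
    · rw [← hz 0 le_rfl]; exact hmono h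
  have h11 : ∀ x, ψ x ≤ 1 := by
    intro x
    rcases le_total x 1 with h | h
    · rw [← ho 1 le_rfl]; exact hmono h
    · rw [ho x h]
  refine ⟨ψ, hsm, h01, h11, hz, ho, ?_⟩
  intro n x
  rcases n with _ | n
  · simp only [iteratedDeriv_zero, betaB]
    rw [abs_of_nonneg (h01 x)]
    simpa using h11 x
  · rw [iteratedDeriv_succ', hd, iteratedDeriv_mul_const_field, abs_mul]
    have hinv : |I⁻¹| ≤ 16 := by
      rw [abs_of_pos (by positivity), inv_le_comm₀ hIpos (by norm_num)]
      norm_num at hIl ⊢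
      linarith
    have hfac : (n.factorial : ℝ) ≤ ((n + 1 : ℕ) : ℝ) ^ (2 * (n + 1)) := by
      have : n.factorial ≤ (n + 1) ^ (2 * (n + 1)) :=
        (Nat.factorial_le_pow n).trans ((Nat.pow_le_pow_left (Nat.le_succ n) n).trans
          (Nat.pow_le_pow_right (Nat.succ_pos n) (by omega)))
      exact_mod_cast this
    calc _ ≤ ((n + 1) * 32 ^ n * (n.factorial : ℝ) ^ 2) * 16 := by
          gcongr
          exact bumpG_bound n x
      _ = (32 ^ n * 16) * ((n + 1) * (n.factorial : ℝ)) * (n.factorial : ℝ) := by ring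
      _ ≤ (64 ^ n * 64) * ((n + 1) * (n.factorial : ℝ)) * ((n + 1 : ℕ) : ℝ) ^ (2 * (n + 1)) := by
          gcongr <;> norm_num
      _ = betaB (n + 1) := by
          rw [betaB, Nat.factorial_succ, pow_succ]
          push_cast
          ring

lemma betaB_nonneg (a : ℕ) : 0 ≤ betaB a := by unfold betaB; positivity

lemma betaB_mul (a b : ℕ) : betaB a * betaB b ≤ betaB (a + b) := by
  have h1 : (a.factorial : ℝ) * b.factorial ≤ (a + b).factorial := by
    exact_mod_cast Nat.le_of_dvd (Nat.factorial_pos _) (Nat.factorial_mul_factorial_dvd_factorial_add a b)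
  calc betaB a * betaB b = 64 ^ (a + b) * ((a.factorial : ℝ) * b.factorial) *
        ((a : ℝ) ^ (2 * a) * (b : ℝ) ^ (2 * b)) := by unfold betaB; ring
    _ ≤ 64 ^ (a + b) * ((a + b).factorial : ℝ) *
        (((a + b : ℕ) : ℝ) ^ (2 * a) * ((a + b : ℕ) : ℝ) ^ (2 * b)) := by
        gcongr <;> omega
    _ = betaB (a + b) := by rw [← pow_add]; unfold betaB; ring_nf

lemma betaB_prod {ι : Type*} (s : Finset ι) (J : ι → ℕ) :
    ∏ i ∈ s, betaB (J i) ≤ betaB (∑ i ∈ s, J i) := by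
  classical
  induction s using Finset.induction_on with
  | empty => simp [betaB]
  | insert a s ha ih =>
    rw [Finset.prod_insert ha, Finset.sum_insert ha]
    exact (mul_le_mul_of_nonneg_left ih (betaB_nonneg _)).trans (betaB_mul _ _)

lemma betaB_le {k : ℕ} (hk : 1 ≤ k) : betaB k ≤ mollifierBound k := by
  have hk' : (1 : ℝ) ≤ k := by exact_mod_cast hk
  have he : (1 : ℝ) ≤ 2 * Real.exp 1 := by linarith [Real.add_one_le_exp (1 : ℝ)]
  have h2 : (k : ℝ) ^ (2 * k) ≤ (k : ℝ) ^ (2 * k + 2) := pow_le_pow_right₀ hk' (by omega)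
  calc betaB k = 1 * 64 ^ k * (k.factorial : ℝ) * (k : ℝ) ^ (2 * k) := by unfold betaB; ring
    _ ≤ _ := by unfold mollifierBound; gcongr

section prodsum

variable {d : ℕ}

lemma partialDeriv_prodsum (S : Finset (Fin d → ℝ)) (f : (Fin d → ℝ) → Fin d → ℝ → ℝ)
    (hf : ∀ σ i, ContDiff ℝ (⊤ : ℕ∞) (f σ i)) (k : Fin d) :
    partialDeriv k (fun X => ∑ σ ∈ S, ∏ i, f σ i (X i)) =
      fun X => ∑ σ ∈ S, ∏ i, (if i = k then deriv (f σ i) else f σ i) (X i) := by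
  funext X
  have hdiff : Differentiable ℝ (fun X : Fin d → ℝ => ∑ σ ∈ S, ∏ i, f σ i (X i)) := by
    have : ContDiff ℝ (⊤ : ℕ∞) (fun X : Fin d → ℝ => ∑ σ ∈ S, ∏ i, f σ i (X i)) := by
      refine ContDiff.sum fun σ _ => contDiff_prod fun i _ => ?_
      exact (hf σ i).comp (contDiff_apply ℝ ℝ i)
    exact this.differentiable (by simp)
  have h1 : HasDerivAt (fun t : ℝ => ∑ σ ∈ S, ∏ i, f σ i (Function.update X k t i))
      (partialDeriv k (fun X => ∑ σ ∈ S, ∏ i, f σ i (X i)) X) (X k) := by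
    have hu := hasDerivAt_update X k (X k)
    have hF := (hdiff (Function.update X k (X k))).hasFDerivAt
    have := hF.comp_hasDerivAt (X k) hu
    rw [Function.update_eq_self] at this
    exact this
  have h2 : HasDerivAt (fun t : ℝ => ∑ σ ∈ S, ∏ i, f σ i (Function.update X k t i))
      (∑ σ ∈ S, ∏ i, (if i = k then deriv (f σ i) else f σ i) (X i)) (X k) := by
    refine HasDerivAt.fun_sum fun σ _ => ?_
    have e1 : (fun t : ℝ => ∏ i, f σ i (Function.update X k t i)) =
        fun t => f σ k t * ∏ i ∈ Finset.univ.erase k, f σ i (X i) := by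
      funext t
      rw [← Finset.mul_prod_erase _ _ (Finset.mem_univ k)]
      congr 1
      · simp
      · refine Finset.prod_congr rfl fun i hi => ?_
        rw [Function.update_of_ne (Finset.ne_of_mem_erase hi)]
    have e2 : (∏ i, (if i = k then deriv (f σ i) else f σ i) (X i)) =
        deriv (f σ k) (X k) * ∏ i ∈ Finset.univ.erase k, f σ i (X i) := by
      rw [← Finset.mul_prod_erase _ _ (Finset.mem_univ k)]
      congr 1
      · simp
      · refine Finset.prod_congr rfl fun i hi => ?_
        rw [if_neg (Finset.ne_of_mem_erase hi)]
    rw [e1, e2]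
    exact ((((hf σ k).differentiable (by simp)) (X k)).hasDerivAt).mul_const _
  exact h1.unique h2

lemma aux_smooth_iter {g : ℝ → ℝ} (hg : ContDiff ℝ (⊤ : ℕ∞) g) (n : ℕ) :
    ContDiff ℝ (⊤ : ℕ∞) (iteratedDeriv n g) := by
  induction n with
  | zero => simpa using hg
  | succ n ih =>
    rw [iteratedDeriv_succ]
    exact (contDiff_infty_iff_deriv.1 ih).2

lemma partialDeriv_iter_prodsum (S : Finset (Fin d → ℝ)) (f : (Fin d → ℝ) → Fin d → ℝ → ℝ)
    (hf : ∀ σ i, ContDiff ℝ (⊤ : ℕ∞) (f σ i)) (k : Fin d) (n : ℕ) :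
    (partialDeriv k)^[n] (fun X => ∑ σ ∈ S, ∏ i, f σ i (X i)) =
      fun X => ∑ σ ∈ S, ∏ i, (if i = k then iteratedDeriv n (f σ i) else f σ i) (X i) := by
  induction n with
  | zero => simp
  | succ n ih =>
    rw [Function.iterate_succ_apply', ih, partialDeriv_prodsum S
      (fun σ i => if i = k then iteratedDeriv n (f σ i) else f σ i)]
    · funext X
      refine Finset.sum_congr rfl fun σ _ => Finset.prod_congr rfl fun i _ => ?_
      by_cases h : i = k
      · simp [h, iteratedDeriv_succ]
      · simp [h]
    · intro σ i
      by_cases h : i = k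
      · simpa [h] using aux_smooth_iter (hf σ k) n
      · simpa [h] using hf σ i

lemma foldr_prodsum (S : Finset (Fin d → ℝ)) (f : (Fin d → ℝ) → Fin d → ℝ → ℝ)
    (hf : ∀ σ i, ContDiff ℝ (⊤ : ℕ∞) (f σ i)) (J : Fin d → ℕ) (l : List (Fin d)) (hl : l.Nodup) :
    l.foldr (fun i g => (partialDeriv i)^[J i] g) (fun X => ∑ σ ∈ S, ∏ i, f σ i (X i)) =
      fun X => ∑ σ ∈ S, ∏ i, (if i ∈ l then iteratedDeriv (J i) (f σ i) else f σ i) (X i) := by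
  induction l with
  | nil => simp
  | cons a l ih =>
    rw [List.nodup_cons] at hl
    rw [List.foldr_cons, ih hl.2, partialDeriv_iter_prodsum S
      (fun σ i => if i ∈ l then iteratedDeriv (J i) (f σ i) else f σ i)]
    · funext X
      refine Finset.sum_congr rfl fun σ _ => Finset.prod_congr rfl fun i _ => ?_
      by_cases h : i = a
      · subst h
        simp [hl.1]
      · simp [h]
    · intro σ i
      split_ifs
      · exact aux_smooth_iter (hf σ i) _
      · exact hf σ i

lemma multiDeriv_prodsum (S : Finset (Fin d → ℝ)) (f : (Fin d → ℝ) → Fin d → ℝ → ℝ)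
    (hf : ∀ σ i, ContDiff ℝ (⊤ : ℕ∞) (f σ i)) (J : Fin d → ℕ) :
    multiDeriv J (fun X => ∑ σ ∈ S, ∏ i, f σ i (X i)) =
      fun X => ∑ σ ∈ S, ∏ i, iteratedDeriv (J i) (f σ i) (X i) := by
  rw [multiDeriv, foldr_prodsum S f hf J _ (List.nodup_finRange d)]
  simp

end prodsum

lemma iter_zero_left {g : ℝ → ℝ} (hg : ContDiff ℝ (⊤ : ℕ∞) g) (h0 : ∀ x ≤ 0, g x = 0)
    (n : ℕ) (x : ℝ) (hx : x ≤ 0) : iteratedDeriv n g x = 0 := by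
  have h1 : Set.EqOn (iteratedDeriv n g) (fun _ => 0) (Set.Iio 0) := by
    have := Set.EqOn.iteratedDeriv_of_isOpen (f := g) (g := fun _ => (0 : ℝ)) (s := Set.Iio 0)
      (fun y hy => h0 y (le_of_lt hy)) isOpen_Iio n
    intro y hy
    rw [this hy]
    simp [iteratedDeriv_const]
  have h2 := h1.closure (aux_smooth_iter hg n).continuous continuous_const
  rw [closure_Iio] at h2
  exact h2 hx

lemma iter_zero_right {g : ℝ → ℝ} (h1 : ∀ x, 1 ≤ x → g x = 1)
    (n : ℕ) (hn : n ≠ 0) (x : ℝ) (hx : 1 < x) : iteratedDeriv n g x = 0 := by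
  have := Set.EqOn.iteratedDeriv_of_isOpen (f := g) (g := fun _ => (1 : ℝ)) (s := Set.Ioi 1)
      (fun y hy => h1 y (le_of_lt hy)) isOpen_Ioi n
  rw [this hx]
  simp [iteratedDeriv_const, hn]

/-- Mollifier for a union O of (pairwise disjoint) open orthants of ℝ^d, where each orthant
is specified by a sign vector σ in the finite set `Sgn` and
O = {X : ∃ σ ∈ Sgn, ∀ i, σ_i X_i > 0}. -/
theorem stmt12 (d : ℕ) (hd : 0 < d) (Sgn : Finset (Fin d → ℝ))
    (hSgn : ∀ σ ∈ Sgn, ∀ i, σ i = 1 ∨ σ i = -1)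
    (ε : ℝ) (hε : 0 < ε) :
    ∃ Ψ : (Fin d → ℝ) → ℝ, ContDiff ℝ (⊤ : ℕ∞) Ψ ∧ (∀ X, Ψ X ∈ Set.Icc (0 : ℝ) 1) ∧
      (∀ X : Fin d → ℝ, ¬ (∃ σ ∈ Sgn, ∀ i, 0 < σ i * X i) → Ψ X = 0) ∧
      (∀ X : Fin d → ℝ, (∃ σ ∈ Sgn, ∀ i, 0 < σ i * X i) → (∀ i, ε ≤ |X i|) → Ψ X = 1) ∧
      (∀ J : Fin d → ℕ, 1 ≤ ∑ i, J i → ∀ X : Fin d → ℝ,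
        |multiDeriv J Ψ X| ≤ mollifierBound (∑ i, J i) * (1 / ε) ^ (∑ i, J i)) ∧
      (∀ J : Fin d → ℕ, ∀ X : Fin d → ℝ, multiDeriv J Ψ X ≠ 0 →
        (∃ σ ∈ Sgn, ∀ i, 0 < σ i * X i) ∧ (∀ i, J i ≠ 0 → |X i| ≤ ε)) := by
  obtain ⟨ψ, hsm, hψ0, hψ1, hz, ho, hb⟩ := exists_step
  set f : (Fin d → ℝ) → Fin d → ℝ → ℝ := fun σ i x => ψ (σ i / ε * x) with hfdef
  have hf : ∀ σ i, ContDiff ℝ (⊤ : ℕ∞) (f σ i) := fun σ i =>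
    hsm.comp (contDiff_const.mul contDiff_id)
  have hit : ∀ σ i n x, iteratedDeriv n (f σ i) x =
      (σ i / ε) ^ n * iteratedDeriv n ψ (σ i / ε * x) := by
    intro σ i n x
    have := iteratedDeriv_comp_const_mul (n := n) (f := ψ)
      (hsm.of_le (by exact_mod_cast le_top)) (σ i / ε)
    exact congrFun this x
  have hvan : ∀ σ i n x, ¬ 0 < σ i * x → iteratedDeriv n (f σ i) x = 0 := by
    intro σ i n x hx
    rw [hit, iter_zero_left hsm hz n _ ?_, mul_zero]
    rw [div_mul_eq_mul_div]
    exact div_nonpos_of_nonpos_of_nonneg (not_lt.1 hx) hε.le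
  have habs : ∀ σ ∈ Sgn, ∀ i, |σ i| = 1 := by
    intro σ hσ i
    rcases hSgn σ hσ i with h | h <;> simp [h]
  have hpos : ∀ σ ∈ Sgn, ∀ i x, 0 < σ i * x → σ i * x = |x| := by
    intro σ hσ i x hx
    rw [← abs_of_pos hx, abs_mul, habs σ hσ i, one_mul]
  -- all the terms vanish except the one of the orthant of `X`
  have hzero : ∀ (J : Fin d → ℕ) (X : Fin d → ℝ), ¬ (∃ σ ∈ Sgn, ∀ i, 0 < σ i * X i) →
      ∑ σ ∈ Sgn, ∏ i, iteratedDeriv (J i) (f σ i) (X i) = 0 := by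
    intro J X hX
    push Not at hX
    refine Finset.sum_eq_zero fun σ hσ => ?_
    obtain ⟨i, hi⟩ := hX σ hσ
    exact Finset.prod_eq_zero (Finset.mem_univ i) (hvan σ i _ _ (not_lt.2 hi))
  have hone : ∀ (J : Fin d → ℕ) (X : Fin d → ℝ), ∀ σ ∈ Sgn, (∀ i, 0 < σ i * X i) →
      ∑ σ ∈ Sgn, ∏ i, iteratedDeriv (J i) (f σ i) (X i) =
        ∏ i, iteratedDeriv (J i) (f σ i) (X i) := by
    intro J X σ hσ hX
    refine Finset.sum_eq_single σ (fun τ hτ hne => ?_) (fun h => absurd hσ h)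
    have : ∃ i, ¬ 0 < τ i * X i := by
      by_contra hcon
      push Not at hcon
      apply hne
      funext i
      have h1 := hX i
      have h2 := hcon i
      rcases hSgn σ hσ i with h | h <;> rcases hSgn τ hτ i with h' | h' <;>
        rw [h] at h1 ⊢ <;> rw [h'] at h2 ⊢ <;> linarith
    obtain ⟨i, hi⟩ := this
    exact Finset.prod_eq_zero (Finset.mem_univ i) (hvan τ i _ _ hi)
  set Ψ : (Fin d → ℝ) → ℝ := fun X => ∑ σ ∈ Sgn, ∏ i, f σ i (X i) with hΨ
  have hΨ0 : ∀ X, Ψ X = ∑ σ ∈ Sgn, ∏ i, iteratedDeriv ((fun _ => 0 : Fin d → ℕ) i) (f σ i) (X i) := by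
    intro X
    simp [hΨ]
  refine ⟨Ψ, ?_, ?_, ?_, ?_, ?_, ?_⟩
  · refine ContDiff.sum fun σ _ => contDiff_prod fun i _ => ?_
    exact (hf σ i).comp (contDiff_apply ℝ ℝ i)
  · intro X
    by_cases hX : ∃ σ ∈ Sgn, ∀ i, 0 < σ i * X i
    · obtain ⟨σ, hσ, hX⟩ := hX
      rw [hΨ0, hone _ X σ hσ hX]
      simp only [iteratedDeriv_zero]
      exact ⟨Finset.prod_nonneg fun i _ => hψ0 _,
        Finset.prod_le_one (fun i _ => hψ0 _) fun i _ => hψ1 _⟩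
    · rw [hΨ0, hzero _ X hX]
      simp
  · intro X hX
    rw [hΨ0, hzero _ X hX]
  · rintro X ⟨σ, hσ, hX⟩ hXε
    rw [hΨ0, hone _ X σ hσ hX]
    simp only [iteratedDeriv_zero]
    refine Finset.prod_eq_one fun i _ => ho _ ?_
    rw [div_mul_eq_mul_div, hpos σ hσ i _ (hX i), le_div_iff₀ hε, one_mul]
    exact hXε i
  · intro J hJ X
    have hnn : 0 ≤ (1 / ε) ^ (∑ i, J i) := by positivity
    rw [hΨ, multiDeriv_prodsum Sgn f hf J]
    refine le_trans ?_ (mul_le_mul_of_nonneg_right (betaB_le hJ) hnn)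
    by_cases hX : ∃ σ ∈ Sgn, ∀ i, 0 < σ i * X i
    · obtain ⟨σ, hσ, hX⟩ := hX
      simp only []
      rw [hone _ X σ hσ hX, Finset.abs_prod]
      have hterm : ∀ i, |iteratedDeriv (J i) (f σ i) (X i)| ≤ betaB (J i) * (1 / ε) ^ J i := by
        intro i
        rw [hit, abs_mul, abs_pow, abs_div, habs σ hσ i, abs_of_pos hε, mul_comm]
        exact mul_le_mul_of_nonneg_right (hb _ _) (by positivity)
      calc _ ≤ ∏ i, (betaB (J i) * (1 / ε) ^ J i) :=
            Finset.prod_le_prod (fun i _ => abs_nonneg _) fun i _ => hterm i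
        _ = (∏ i, betaB (J i)) * (1 / ε) ^ (∑ i, J i) := by
            rw [Finset.prod_mul_distrib, Finset.prod_pow_eq_pow_sum]
        _ ≤ _ := mul_le_mul_of_nonneg_right (betaB_prod _ _) hnn
    · simp only []
      rw [hzero _ X hX, abs_zero]
      exact mul_nonneg (betaB_nonneg _) hnn
  · intro J X hne
    rw [hΨ, multiDeriv_prodsum Sgn f hf J] at hne
    by_cases hX : ∃ σ ∈ Sgn, ∀ i, 0 < σ i * X i
    · refine ⟨hX, ?_⟩
      obtain ⟨σ, hσ, hX⟩ := hX
      simp only [] at hne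
      rw [hone _ X σ hσ hX] at hne
      intro i hi
      by_contra hlt
      push Not at hlt
      apply hne
      refine Finset.prod_eq_zero (Finset.mem_univ i) ?_
      rw [hit, iter_zero_right ho _ hi _ ?_, mul_zero]
      rw [div_mul_eq_mul_div, hpos σ hσ i _ (hX i), lt_div_iff₀ hε, one_mul]
      exact hlt
    · exact absurd (hzero _ X hX) hne
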